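/- The map T_K : V → V, T_Kψ = m_a·(A^{−1}J₂ψ₂, A^{−*}J₁ψ₁) + γ·(−ψ₁, ψ₂), is a bounded linear bijection of V with bounded inverse, and ‖T_Kψ‖ ≤ (1+γ)·‖ψ‖ for all ψ ∈ V. -/

import Mathlib

open scoped RealInnerProductSpace
open Filter Topology

noncomputable section Setup

variable {V₁ V₂ Q W : Type*}
  [NormedAddCommGroup V₁] [InnerProductSpace ℝ V₁]
  [NormedAddCommGroup V₂] [InnerProductSpace ℝ V₂]
  [NormedAddCommGroup Q] [InnerProductSpace ℝ Q]
  [NormedAddCommGroup W] [InnerProductSpace ℝ W]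

/-- The ℓ²-norm on the product space `V = V₁ × V₂`. -/
def nV (v : V₁ × V₂) : ℝ := Real.sqrt (‖v.1‖ ^ 2 + ‖v.2‖ ^ 2)

/-- The seminorm `|v| = (‖I v₁‖² + ‖C* v₂‖²)^{1/2}`. -/
def sV (Cs : V₂ →L[ℝ] Q) (Iop : V₁ →L[ℝ] W) (v : V₁ × V₂) : ℝ :=
  Real.sqrt (‖Iop v.1‖ ^ 2 + ‖Cs v.2‖ ^ 2)

/-- The vectorized bilinear form `a(v,φ) = a(v₁,φ₂) + a(φ₁,v₂)` on `V × V`. -/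
def aV (a : V₁ →L[ℝ] V₂ →L[ℝ] ℝ) (v φ : V₁ × V₂) : ℝ := a v.1 φ.2 + a φ.1 v.2

/-- The bilinear form `b = a + α^{-1/2} c` of the rescaled reduced optimality system. -/
def bV (a : V₁ →L[ℝ] V₂ →L[ℝ] ℝ) (Cs : V₂ →L[ℝ] Q) (Iop : V₁ →L[ℝ] W) (α : ℝ)
    (v φ : V₁ × V₂) : ℝ :=
  aV a v φ + (Real.sqrt α)⁻¹ * (⟪Cs v.2, Cs φ.2⟫ - ⟪Iop v.1, Iop φ.1⟫)

/-- Continuity constant `M_a = sup { a(v₁,v₂) : ‖v₁‖ = 1, ‖v₂‖ = 1 }`. -/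
def contConst (a : V₁ →L[ℝ] V₂ →L[ℝ] ℝ) : ℝ :=
  sSup {r : ℝ | ∃ v₁ : V₁, ∃ v₂ : V₂, ‖v₁‖ = 1 ∧ ‖v₂‖ = 1 ∧ r = a v₁ v₂}

/-- Inf-sup constant `m_a = inf_{‖v₂‖=1} sup_{‖v₁‖=1} a(v₁,v₂)`. -/
def infSupConst (a : V₁ →L[ℝ] V₂ →L[ℝ] ℝ) : ℝ :=
  sInf {r : ℝ | ∃ v₂ : V₂, ‖v₂‖ = 1 ∧
    r = sSup {s : ℝ | ∃ v₁ : V₁, ‖v₁‖ = 1 ∧ s = a v₁ v₂}}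

/-- Discrete inf-sup constant of `a` on `V_{h,1} × V_{h,2}`. -/
def discInfSup (a : V₁ →L[ℝ] V₂ →L[ℝ] ℝ) (Vh1 : Submodule ℝ V₁)
    (Vh2 : Submodule ℝ V₂) : ℝ :=
  sInf {r : ℝ | ∃ v₁ ∈ Vh1, ‖v₁‖ = 1 ∧
    r = sSup {s : ℝ | ∃ φ₂ ∈ Vh2, ‖φ₂‖ = 1 ∧ s = a v₁ φ₂}}

/-- Best approximation error `inf_{v_h ∈ V_h} ‖x - v_h‖` in the product norm. -/
def bestErr (Vh1 : Submodule ℝ V₁) (Vh2 : Submodule ℝ V₂) (x : V₁ × V₂) : ℝ :=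
  sInf {r : ℝ | ∃ vh : V₁ × V₂, vh.1 ∈ Vh1 ∧ vh.2 ∈ Vh2 ∧ r = nV (x - vh)}

/-- The quasi-best-approximation constant `ν_h` of the Galerkin discretization of `b`:
`sup` over nonzero discrete test functions of the ratio of the continuous sup to the
discrete sup. -/
def nuConst (a : V₁ →L[ℝ] V₂ →L[ℝ] ℝ) (Cs : V₂ →L[ℝ] Q) (Iop : V₁ →L[ℝ] W) (α : ℝ)
    (Vh1 : Submodule ℝ V₁) (Vh2 : Submodule ℝ V₂) : ℝ :=
  sSup {r : ℝ | ∃ φh : V₁ × V₂, φh.1 ∈ Vh1 ∧ φh.2 ∈ Vh2 ∧ φh ≠ 0 ∧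
    r = sSup {s : ℝ | ∃ v : V₁ × V₂, nV v = 1 ∧ s = bV a Cs Iop α v φh} /
        sSup {s : ℝ | ∃ vh : V₁ × V₂, vh.1 ∈ Vh1 ∧ vh.2 ∈ Vh2 ∧ nV vh = 1 ∧
          s = bV a Cs Iop α vh φh}}

/-- The nonlinear form `c_{K,α}` associated with the control constraint set `K`
(through its metric projection `PK`). -/
def cK (Cs : V₂ →L[ℝ] Q) (Iop : V₁ →L[ℝ] W) (PK : Q → Q) (α : ℝ) (v φ : V₁ × V₂) : ℝ :=
  -⟪PK ((-(Real.sqrt α)⁻¹) • (Cs v.2)), Cs φ.2⟫ - (Real.sqrt α)⁻¹ * ⟪Iop v.1, Iop φ.1⟫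

/-- The nonlinear form `b_K = a + c_{K,α}`. -/
def bK (a : V₁ →L[ℝ] V₂ →L[ℝ] ℝ) (Cs : V₂ →L[ℝ] Q) (Iop : V₁ →L[ℝ] W) (PK : Q → Q)
    (α : ℝ) (v φ : V₁ × V₂) : ℝ :=
  aV a v φ + cK Cs Iop PK α v φ

/-- The pseudometric `δ_{K,α}`. -/
def deltaK (Cs : V₂ →L[ℝ] Q) (Iop : V₁ →L[ℝ] W) (PK : Q → Q) (α : ℝ)
    (v w : V₁ × V₂) : ℝ :=
  Real.sqrt (α * ‖PK ((-(Real.sqrt α)⁻¹) • (Cs v.2)) -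
      PK ((-(Real.sqrt α)⁻¹) • (Cs w.2))‖ ^ 2 + ‖Iop (v.1 - w.1)‖ ^ 2)

end Setup

lemma nV_sq {V₁ V₂ : Type*} [NormedAddCommGroup V₁] [NormedAddCommGroup V₂] (v : V₁ × V₂) :
    nV v ^ 2 = ‖v.1‖ ^ 2 + ‖v.2‖ ^ 2 :=
  Real.sq_sqrt (by positivity)

lemma nV_nonneg {V₁ V₂ : Type*} [NormedAddCommGroup V₁] [NormedAddCommGroup V₂] (v : V₁ × V₂) :
    0 ≤ nV v :=
  Real.sqrt_nonneg _

section Helpers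

variable {V₁ V₂ : Type*}
  [NormedAddCommGroup V₁] [InnerProductSpace ℝ V₁]
  [NormedAddCommGroup V₂] [InnerProductSpace ℝ V₂]

/-- A bound on `a(·, v₂)` bounds `v₂` through the inf-sup constant. -/
lemma infSupConst_mul_norm_le {a : V₁ →L[ℝ] V₂ →L[ℝ] ℝ} (ha : 0 < infSupConst a)
    {v₂ : V₂} {C : ℝ} (hC : 0 ≤ C) (h : ∀ v₁ : V₁, a v₁ v₂ ≤ C * ‖v₁‖) :
    infSupConst a * ‖v₂‖ ≤ C := by
  rcases eq_or_ne v₂ 0 with rfl | hv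
  · simpa using hC
  have hn : 0 < ‖v₂‖ := norm_pos_iff.mpr hv
  have hbdd : BddBelow {r : ℝ | ∃ v₂ : V₂, ‖v₂‖ = 1 ∧
      r = sSup {s : ℝ | ∃ v₁ : V₁, ‖v₁‖ = 1 ∧ s = a v₁ v₂}} := by
    by_contra hb
    exact ha.ne' (Real.sInf_of_not_bddBelow hb)
  have hle : infSupConst a ≤ C / ‖v₂‖ := by
    refine (csInf_le hbdd ⟨‖v₂‖⁻¹ • v₂, ?_, rfl⟩).trans (Real.sSup_le ?_ (by positivity))
    · rw [norm_smul, norm_inv, norm_norm, inv_mul_cancel₀ hn.ne']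
    · rintro s ⟨v₁, hv₁, rfl⟩
      have h' := h v₁
      rw [hv₁, mul_one] at h'
      rw [map_smul, smul_eq_mul, inv_mul_eq_div]
      gcongr
  rwa [le_div_iff₀ hn] at hle

lemma norm_le_opNorm_mul_norm_left {a : V₁ →L[ℝ] V₂ →L[ℝ] ℝ} {w₁ : V₁} {x : V₂}
    (h : ∀ φ₂ : V₂, a w₁ φ₂ = ⟪x, φ₂⟫) : ‖x‖ ≤ ‖a‖ * ‖w₁‖ := by
  rcases eq_or_ne x 0 with rfl | hx
  · rw [norm_zero]; positivity
  have h1 := h x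
  rw [real_inner_self_eq_norm_sq] at h1
  have h2 := (le_abs_self _).trans (a.le_opNorm₂ w₁ x)
  rw [h1, sq] at h2
  exact le_of_mul_le_mul_right h2 (norm_pos_iff.mpr hx)

lemma norm_le_opNorm_mul_norm_right {a : V₁ →L[ℝ] V₂ →L[ℝ] ℝ} {w₂ : V₂} {x : V₁}
    (h : ∀ φ₁ : V₁, a φ₁ w₂ = ⟪x, φ₁⟫) : ‖x‖ ≤ ‖a‖ * ‖w₂‖ := by
  simpa using norm_le_opNorm_mul_norm_left (a := a.flip) (w₁ := w₂) (x := x) (by simpa using h)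

/-- If `R` and `S` are mutually adjoint and `S` is bounded below, then `g² + m² R S` is onto. -/
lemma surjective_sq_smul_add_comp [CompleteSpace V₁] {R : V₂ →L[ℝ] V₁} {S : V₁ →L[ℝ] V₂}
    (hRS : ∀ x y, ⟪R x, y⟫ = ⟪x, S y⟫) {K m : ℝ} (hK : 0 ≤ K) (hm : 0 < m)
    (hS : ∀ x, ‖x‖ ≤ K * ‖S x‖) (g : ℝ) (y : V₁) :
    ∃ x, g ^ 2 • x + m ^ 2 • R (S x) = y := by
  let D : V₁ →L[ℝ] V₁ := g ^ 2 • ContinuousLinearMap.id ℝ V₁ + m ^ 2 • R.comp S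
  have hD : IsUnit D := by
    have hd : 0 < m ^ 2 / (K + 1) ^ 2 := by positivity
    refine ContinuousLinearMap.isUnit_of_forall_le_norm_inner_map D (Real.toNNReal_pos.mpr hd) fun x => ?_
    have hin : ⟪D x, x⟫ = g ^ 2 * ‖x‖ ^ 2 + m ^ 2 * ‖S x‖ ^ 2 := by
      simp [D, inner_add_left, real_inner_smul_left, hRS]
    rw [hin]
    refine le_trans ?_ (Real.le_norm_self _)
    rw [Real.coe_toNNReal _ hd.le]
    have h1 : ‖x‖ ≤ (K + 1) * ‖S x‖ := by linarith [hS x, norm_nonneg (S x)]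
    have h2 : ‖x‖ ^ 2 / (K + 1) ^ 2 ≤ ‖S x‖ ^ 2 := by
      rw [div_le_iff₀ (by positivity), mul_comm, ← mul_pow]
      gcongr
    calc ‖x‖ ^ 2 * (m ^ 2 / (K + 1) ^ 2) = m ^ 2 * (‖x‖ ^ 2 / (K + 1) ^ 2) := by ring
      _ ≤ m ^ 2 * ‖S x‖ ^ 2 := by gcongr
      _ ≤ _ := le_add_of_nonneg_left (by positivity)
  obtain ⟨u, hu⟩ := hD
  refine ⟨(↑u⁻¹ : V₁ →L[ℝ] V₁) y, ?_⟩
  have h := congrArg (fun F : V₁ →L[ℝ] V₁ => F y) u.mul_inv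
  rw [hu] at h
  simpa [D] using h

/-- For mutually adjoint `R` and `S`, the cross terms in the norm of the block operator cancel. -/
lemma nV_sq_block {R : V₂ →L[ℝ] V₁} {S : V₁ →L[ℝ] V₂}
    (hRS : ∀ x y, ⟪R x, y⟫ = ⟪x, S y⟫) (m g : ℝ) (ψ : V₁ × V₂) :
    nV (m • R ψ.2 - g • ψ.1, m • S ψ.1 + g • ψ.2) ^ 2 =
      m ^ 2 * (‖R ψ.2‖ ^ 2 + ‖S ψ.1‖ ^ 2) + g ^ 2 * nV ψ ^ 2 := by
  rw [nV_sq, nV_sq, norm_sub_sq_real, norm_add_sq_real]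
  simp only [norm_smul, mul_pow, Real.norm_eq_abs, sq_abs, real_inner_smul_left,
    real_inner_smul_right, hRS, real_inner_comm ψ.2 (S ψ.1)]
  ring

end Helpers

/-- the operator `T_K` is a linear isomorphism on `V` with
`‖T_K ψ‖ ≤ (1+γ)‖ψ‖`. -/
theorem stmt15
    {V₁ V₂ Q W : Type*}
    [NormedAddCommGroup V₁] [InnerProductSpace ℝ V₁] [CompleteSpace V₁] [Nontrivial V₁]
    [NormedAddCommGroup V₂] [InnerProductSpace ℝ V₂] [CompleteSpace V₂] [Nontrivial V₂]
    [NormedAddCommGroup Q] [InnerProductSpace ℝ Q] [CompleteSpace Q]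
    [NormedAddCommGroup W] [InnerProductSpace ℝ W] [CompleteSpace W]
    (a : V₁ →L[ℝ] V₂ →L[ℝ] ℝ) (Cs : V₂ →L[ℝ] Q) (Iop : V₁ →L[ℝ] W)
    (α M_a m_a M_C M_I M γ : ℝ) (hα : 0 < α)
    (hMa : M_a = contConst a)
    (hma : m_a = infSupConst a) (hma_pos : 0 < m_a)
    (hnd : ∀ v₁ : V₁, (∀ v₂ : V₂, a v₁ v₂ = 0) → v₁ = 0)
    (hMC : M_C = ‖Cs‖) (hMI : M_I = ‖Iop‖) (hM : M = max M_I M_C)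
    (hγ : γ = (M / m_a) * (1 + 2 * M / Real.sqrt α))
    (TK : V₁ × V₂ → V₁ × V₂)
    (hTK : ∀ ψ : V₁ × V₂, ∃ w₁ : V₁, ∃ w₂ : V₂,
      (∀ φ₂ : V₂, a w₁ φ₂ = ⟪ψ.2, φ₂⟫) ∧ (∀ φ₁ : V₁, a φ₁ w₂ = ⟪ψ.1, φ₁⟫) ∧
      TK ψ = (m_a • w₁ - γ • ψ.1, m_a • w₂ + γ • ψ.2)) :
    (∀ ψ χ : V₁ × V₂, TK (ψ + χ) = TK ψ + TK χ) ∧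
    (∀ (t : ℝ) (ψ : V₁ × V₂), TK (t • ψ) = t • TK ψ) ∧
    Function.Bijective TK ∧
    (∀ ψ : V₁ × V₂, nV (TK ψ) ≤ (1 + γ) * nV ψ) ∧
    (∃ c : ℝ, ∀ ψ : V₁ × V₂, nV ψ ≤ c * nV (TK ψ)) := by
  have hinf : ∀ w₂ x, (∀ φ₁ : V₁, a φ₁ w₂ = ⟪x, φ₁⟫) → m_a * ‖w₂‖ ≤ ‖x‖ := by
    intro w₂ x h
    rw [hma] at hma_pos ⊢
    exact infSupConst_mul_norm_le hma_pos (norm_nonneg x)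
      fun v₁ => (h v₁).trans_le (real_inner_le_norm x v₁)
  have hinf' : ∀ w₁ x, (∀ φ₂ : V₂, a w₁ φ₂ = ⟪x, φ₂⟫) → m_a * ‖w₁‖ ≤ ‖x‖ := by
    intro w₁ x h
    rcases eq_or_ne w₁ 0 with rfl | hw
    · simp
    obtain ⟨-, z, -, hz, -⟩ := hTK (w₁, 0)
    have h1 := hinf z w₁ hz
    have h2 : ‖w₁‖ ^ 2 = ⟪x, z⟫ := by
      rw [← h z, hz w₁, real_inner_self_eq_norm_sq]
    refine le_of_mul_le_mul_right ?_ (norm_pos_iff.mpr hw)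
    calc m_a * ‖w₁‖ * ‖w₁‖ = m_a * ⟪x, z⟫ := by rw [← h2]; ring
      _ ≤ m_a * (‖x‖ * ‖z‖) := by gcongr; exact real_inner_le_norm x z
      _ = ‖x‖ * (m_a * ‖z‖) := by ring
      _ ≤ ‖x‖ * ‖w₁‖ := by gcongr
  choose f g hf hg hT using hTK
  have uniqR : ∀ u v : V₁, (∀ φ₂, a u φ₂ = a v φ₂) → u = v := fun u v h =>
    sub_eq_zero.mp (hnd _ fun φ₂ => by simp [h])
  have uniqS : ∀ u v : V₂, (∀ φ₁, a φ₁ u = a φ₁ v) → u = v := fun u v h => by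
    have h0 := hinf (u - v) 0 fun φ₁ => by simp [h]
    rw [norm_zero] at h0
    exact sub_eq_zero.mp (norm_le_zero_iff.mp (nonpos_of_mul_nonpos_right h0 hma_pos))
  let R : V₂ →L[ℝ] V₁ := LinearMap.mkContinuous
    { toFun := fun x => f (0, x)
      map_add' := fun x y => uniqR _ _ fun φ => by simp [hf, inner_add_left]
      map_smul' := fun t x => uniqR _ _ fun φ => by simp [hf, real_inner_smul_left] } m_a⁻¹
    fun x => (le_inv_mul_iff₀ hma_pos).mpr (hinf' _ _ (hf (0, x)))
  let S : V₁ →L[ℝ] V₂ := LinearMap.mkContinuous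
    { toFun := fun x => g (x, 0)
      map_add' := fun x y => uniqS _ _ fun φ => by simp [hg, inner_add_left]
      map_smul' := fun t x => uniqS _ _ fun φ => by simp [hg, real_inner_smul_left] } m_a⁻¹
    fun x => (le_inv_mul_iff₀ hma_pos).mpr (hinf _ _ (hg (x, 0)))
  have hR : ∀ x φ, a (R x) φ = ⟪x, φ⟫ := fun x => hf (0, x)
  have hS : ∀ x φ, a φ (S x) = ⟪x, φ⟫ := fun x => hg (x, 0)
  have hT' : ∀ ψ, TK ψ = (m_a • R ψ.2 - γ • ψ.1, m_a • S ψ.1 + γ • ψ.2) := fun ψ => by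
    rw [hT, uniqR (f ψ) (R ψ.2) fun φ => by rw [hf, hR],
      uniqS (g ψ) (S ψ.1) fun φ => by rw [hg, hS]]
  have hRS : ∀ x y, ⟪R x, y⟫ = ⟪x, S y⟫ := fun x y => by
    rw [← hR, hS, real_inner_comm]
  have hSR : ∀ x y, ⟪S x, y⟫ = ⟪x, R y⟫ := fun x y => by
    rw [real_inner_comm, ← hRS, real_inner_comm]
  have hRle : ∀ x, ‖x‖ ≤ ‖a‖ * ‖R x‖ := fun x => norm_le_opNorm_mul_norm_left (hR x)
  have hSle : ∀ x, ‖x‖ ≤ ‖a‖ * ‖S x‖ := fun x => norm_le_opNorm_mul_norm_right (hS x)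
  have hγ0 : 0 ≤ γ := by
    have hM0 : 0 ≤ M := by rw [hM, hMI]; exact le_max_of_le_left (norm_nonneg _)
    rw [hγ]; positivity
  have hnorm : ∀ ψ, nV (TK ψ) ^ 2 =
      m_a ^ 2 * (‖R ψ.2‖ ^ 2 + ‖S ψ.1‖ ^ 2) + γ ^ 2 * nV ψ ^ 2 := fun ψ => by
    rw [hT', nV_sq_block hRS]
  have hlow : ∀ ψ, nV ψ ≤ ‖a‖ / m_a * nV (TK ψ) := fun ψ => by
    refine (sq_le_sq₀ (nV_nonneg _) (mul_nonneg (by positivity) (nV_nonneg _))).mp ?_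
    have h1 : ‖ψ.2‖ ^ 2 ≤ (‖a‖ * ‖R ψ.2‖) ^ 2 := by gcongr; exact hRle _
    have h2 : ‖ψ.1‖ ^ 2 ≤ (‖a‖ * ‖S ψ.1‖) ^ 2 := by gcongr; exact hSle _
    calc nV ψ ^ 2 ≤ ‖a‖ ^ 2 * (‖R ψ.2‖ ^ 2 + ‖S ψ.1‖ ^ 2) := by rw [nV_sq]; linarith
      _ = (‖a‖ / m_a) ^ 2 * (m_a ^ 2 * (‖R ψ.2‖ ^ 2 + ‖S ψ.1‖ ^ 2)) := by field_simp
      _ ≤ (‖a‖ / m_a) ^ 2 * nV (TK ψ) ^ 2 := by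
        rw [hnorm]
        gcongr
        exact le_add_of_nonneg_right (by positivity)
      _ = _ := by ring
  have hadd : ∀ ψ χ : V₁ × V₂, TK (ψ + χ) = TK ψ + TK χ := fun ψ χ => by
    simp only [hT', Prod.fst_add, Prod.snd_add, map_add, smul_add, Prod.mk_add_mk]
    congr 1 <;> abel
  have hsmul : ∀ (t : ℝ) (ψ : V₁ × V₂), TK (t • ψ) = t • TK ψ := fun t ψ => by
    simp only [hT', Prod.smul_fst, Prod.smul_snd, map_smul, Prod.smul_mk, smul_sub, smul_add,
      smul_comm t]
  refine ⟨hadd, hsmul, ⟨fun ψ χ h => ?_, fun χ => ?_⟩, fun ψ => ?_, ‖a‖ / m_a, hlow⟩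
  · have h0 : TK (ψ - χ) = 0 := by
      rw [sub_eq_add_neg, ← neg_one_smul ℝ χ, hadd, hsmul, h]; simp
    have h1 := hlow (ψ - χ)
    have h2 := nV_sq (ψ - χ)
    rw [h0] at h1
    have h3 : nV (ψ - χ) = 0 := le_antisymm (by simpa [nV] using h1) (nV_nonneg _)
    rw [h3] at h2
    have h4 : ‖(ψ - χ).1‖ = 0 := by nlinarith [norm_nonneg (ψ - χ).1, sq_nonneg ‖(ψ - χ).2‖]
    have h5 : ‖(ψ - χ).2‖ = 0 := by nlinarith [norm_nonneg (ψ - χ).2, sq_nonneg ‖(ψ - χ).1‖]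
    exact sub_eq_zero.mp (Prod.ext (norm_eq_zero.mp h4) (norm_eq_zero.mp h5))
  · obtain ⟨x, hx⟩ := surjective_sq_smul_add_comp hRS (norm_nonneg a) hma_pos hSle γ χ.1
    obtain ⟨y, hy⟩ := surjective_sq_smul_add_comp hSR (norm_nonneg a) hma_pos hRle γ χ.2
    refine ⟨TK (x, y), ?_⟩
    simp only [hT', map_add, map_sub, map_smul]
    refine Prod.ext (Eq.trans ?_ hx) (Eq.trans ?_ hy) <;> dsimp only <;> module
  · refine (sq_le_sq₀ (nV_nonneg _) (mul_nonneg (by positivity) (nV_nonneg _))).mp ?_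
    have h1 : (m_a * ‖R ψ.2‖) ^ 2 ≤ ‖ψ.2‖ ^ 2 := by gcongr; exact hinf' _ _ (hR _)
    have h2 : (m_a * ‖S ψ.1‖) ^ 2 ≤ ‖ψ.1‖ ^ 2 := by gcongr; exact hinf _ _ (hS _)
    have h3 : 0 ≤ γ * nV ψ ^ 2 := by positivity
    have h4 := nV_sq ψ
    rw [hnorm]
    linarith
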